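/- Let u, v ∈ ℕ and let M be a u × v matrix with entries from ℝ⁺ ∪ {0} which is image partition regular over ℝ⁺. If C ⊆ ℝ⁺ is a quasi-central* (QC*) set near zero in ℝ⁺, then {x ∈ (ℝ⁺)^v : M·x ∈ C^u} is a QC* set near zero in (ℝ⁺)^v. -/

import Mathlib

open Set Filter

attribute [local instance] Ultrafilter.add Ultrafilter.addSemigroup

/-- The positive reals `ℝ⁺ = (0,∞)` as a type, a discrete additive semigroup. -/
abbrev Rpos : Type := {x : ℝ // 0 < x}

/-- `0⁺(ℝ⁺)`: ultrafilters on `ℝ⁺` containing `(0,ε)` for every `ε > 0`. -/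
def zeroPlus1 : Set (Ultrafilter Rpos) :=
  {p | ∀ ε : ℝ, 0 < ε → {x : Rpos | (x : ℝ) < ε} ∈ p}

/-- `0⁺((ℝ⁺)^v)`: ultrafilters on `(ℝ⁺)^v` containing `(0,ε)^v` for every `ε > 0`. -/
def zeroPlusV (v : ℕ) : Set (Ultrafilter (Fin v → Rpos)) :=
  {p | ∀ ε : ℝ, 0 < ε → {x : Fin v → Rpos | ∀ j, (x j : ℝ) < ε} ∈ p}

/-- `I` is a (nonempty, two-sided) ideal of the subsemigroup `T` of the ultrafilter
semigroup `βγ`. -/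
def IsIdealIn {γ : Type} [AddSemigroup γ] (T I : Set (Ultrafilter γ)) : Prop :=
  I.Nonempty ∧ I ⊆ T ∧ (∀ p ∈ T, ∀ q ∈ I, p + q ∈ I) ∧ ∀ p ∈ T, ∀ q ∈ I, q + p ∈ I

/-- `p` belongs to the smallest two-sided ideal `K(T)` of `T`: equivalently, `p ∈ T` and
`p` belongs to every nonempty two-sided ideal of `T`. -/
def memK {γ : Type} [AddSemigroup γ] (T : Set (Ultrafilter γ)) (p : Ultrafilter γ) : Prop :=
  p ∈ T ∧ ∀ I : Set (Ultrafilter γ), IsIdealIn T I → p ∈ I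

/-- `M` is image partition regular over `ℝ⁺` (IPR/ℝ⁺): whenever `ℝ⁺` is partitioned into
finitely many cells, there are a cell `i` and `x ∈ (ℝ⁺)^v` such that every entry of `M·x`
lies in `ℝ⁺` and in the cell `i`. -/
def IPR {u v : ℕ} (M : Fin u → Fin v → ℝ) : Prop :=
  ∀ (r : ℕ) (c : Rpos → Fin r), ∃ (i : Fin r) (x : Fin v → Rpos),
    ∀ k : Fin u, ∃ h : 0 < ∑ j, M k j * (x j : ℝ), c ⟨∑ j, M k j * (x j : ℝ), h⟩ = i

/-- `A ⊆ ℝ⁺` is a *quasi-central\* (QC\*) set near zero*: `A` belongs to every idempotent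
lying in the closure of `K(0⁺(ℝ⁺))` in `0⁺(ℝ⁺)`. -/
def QCStar1 (A : Set Rpos) : Prop :=
  ∀ p : Ultrafilter Rpos, p + p = p → p ∈ zeroPlus1 →
    p ∈ closure {q : Ultrafilter Rpos | memK zeroPlus1 q} → A ∈ p

/-- `A ⊆ (ℝ⁺)^v` is a *quasi-central\* (QC\*) set near zero*: `A` belongs to every
idempotent lying in the closure of `K(0⁺((ℝ⁺)^v))` in `0⁺((ℝ⁺)^v)`. -/
def QCStarV (v : ℕ) (A : Set (Fin v → Rpos)) : Prop :=
  ∀ p : Ultrafilter (Fin v → Rpos), p + p = p → p ∈ zeroPlusV v →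
    p ∈ closure {q : Ultrafilter (Fin v → Rpos) | memK (zeroPlusV v) q} → A ∈ p

/-- The map on ultrafilters induced by an additive homomorphism is additive. -/
theorem ultrafilter_map_add {α β : Type} [AddSemigroup α] [AddSemigroup β] (φ : α → β)
    (hφ : ∀ x y, φ (x + y) = φ x + φ y) (p q : Ultrafilter α) :
    (p + q).map φ = p.map φ + q.map φ := by
  refine Ultrafilter.coe_injective (Filter.ext fun s => ?_)
  change (∀ᶠ x in (↑(p + q) : Filter α), φ x ∈ s) ↔
    ∀ᶠ y in (↑(p.map φ + q.map φ) : Filter β), y ∈ s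
  rw [Ultrafilter.eventually_add, Ultrafilter.eventually_add]
  simp only [Ultrafilter.coe_map, Filter.eventually_map, hφ]

theorem continuous_ultrafilter_map {α β : Type} (φ : α → β) :
    Continuous (Ultrafilter.map φ) :=
  ultrafilterBasis_is_basis.continuous_iff.2 <| by
    rintro _ ⟨s, rfl⟩
    exact ultrafilter_isOpen_basic (φ ⁻¹' s)

/-- A homomorphism whose extension maps `T` onto `T'` sends `K(T)` into `K(T')`. -/
theorem memK_map {α β : Type} [AddSemigroup α] [AddSemigroup β] (φ : α → β)
    (hφ : ∀ x y, φ (x + y) = φ x + φ y) {T : Set (Ultrafilter α)} {T' : Set (Ultrafilter β)}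
    (hT : ∀ p ∈ T, ∀ q ∈ T, p + q ∈ T)
    (hmaps : MapsTo (Ultrafilter.map φ) T T') (hsurj : SurjOn (Ultrafilter.map φ) T T')
    {p : Ultrafilter α} (hp : memK T p) : memK T' (p.map φ) := by
  refine ⟨hmaps hp.1, fun I hI => ?_⟩
  obtain ⟨⟨q, hq⟩, hIT, hl, hr⟩ := hI
  obtain ⟨q', hq', rfl⟩ := hsurj (hIT hq)
  refine (hp.2 {t | t ∈ T ∧ t.map φ ∈ I} ⟨⟨q', hq', hq⟩, fun _ ht => ht.1, ?_, ?_⟩).2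
  · rintro s hs t ⟨ht, htI⟩
    exact ⟨hT s hs t ht, by rw [ultrafilter_map_add φ hφ]; exact hl _ (hmaps hs) _ htI⟩
  · rintro s hs t ⟨ht, htI⟩
    exact ⟨hT t ht s hs, by rw [ultrafilter_map_add φ hφ]; exact hr _ (hmaps hs) _ htI⟩

theorem zeroPlusV_add_mem {v : ℕ} {p q : Ultrafilter (Fin v → Rpos)} (hp : p ∈ zeroPlusV v)
    (hq : q ∈ zeroPlusV v) : p + q ∈ zeroPlusV v := by
  intro ε hε
  change ∀ᶠ z in (↑(p + q) : Filter (Fin v → Rpos)), ∀ j, (z j : ℝ) < ε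
  rw [Ultrafilter.eventually_add]
  filter_upwards [hp (ε / 2) (half_pos hε)] with x hx
  filter_upwards [hq (ε / 2) (half_pos hε)] with y hy j
  have hxy : ((x + y) j : ℝ) = x j + y j := rfl
  have := hx j
  have := hy j
  linarith

section RowMap

variable {v : ℕ} (m : Fin v → ℝ)

/-- A row with nonnegative entries, not all zero, has positive product with any
`x ∈ (ℝ⁺)^v`. -/
theorem row_sum_mul_pos (hm : ∀ j, 0 ≤ m j) (hs : 0 < ∑ j, m j) (x : Fin v → Rpos) :
    0 < ∑ j, m j * (x j : ℝ) := by
  obtain ⟨j, hj, hmj⟩ := Finset.exists_lt_of_sum_lt (s := Finset.univ)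
    (f := fun _ : Fin v => (0 : ℝ)) (g := m) (by simpa using hs)
  exact Finset.sum_pos' (fun i _ => mul_nonneg (hm i) (x i).2.le)
    ⟨j, hj, mul_pos hmj (x j).2⟩

/-- The homomorphism `(ℝ⁺)^v → ℝ⁺` given by a nonzero row with nonnegative entries. -/
def rowMap (hm : ∀ j, 0 ≤ m j) (hs : 0 < ∑ j, m j) (x : Fin v → Rpos) : Rpos :=
  ⟨∑ j, m j * (x j : ℝ), row_sum_mul_pos m hm hs x⟩

variable (hm : ∀ j, 0 ≤ m j) (hs : 0 < ∑ j, m j)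

theorem rowMap_add (x y : Fin v → Rpos) :
    rowMap m hm hs (x + y) = rowMap m hm hs x + rowMap m hm hs y := by
  apply Subtype.ext
  change ∑ j, m j * ((x j : ℝ) + y j) = ∑ j, m j * (x j : ℝ) + ∑ j, m j * (y j : ℝ)
  simp only [mul_add, Finset.sum_add_distrib]

theorem mapsTo_map_rowMap :
    MapsTo (Ultrafilter.map (rowMap m hm hs)) (zeroPlusV v) zeroPlus1 := by
  intro p hp ε hε
  change ∀ᶠ x in (p : Filter (Fin v → Rpos)), ∑ j, m j * (x j : ℝ) < ε
  filter_upwards [hp (ε / 2 / ∑ j, m j) (by positivity)] with x hx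
  calc ∑ j, m j * (x j : ℝ) ≤ ∑ j, m j * (ε / 2 / ∑ j, m j) :=
        Finset.sum_le_sum fun j _ => mul_le_mul_of_nonneg_left (hx j).le (hm j)
    _ = ε / 2 := by rw [← Finset.sum_mul]; field_simp
    _ < ε := half_lt_self hε

theorem surjOn_map_rowMap :
    SurjOn (Ultrafilter.map (rowMap m hm hs)) (zeroPlusV v) zeroPlus1 := by
  intro q hq
  let σ : Rpos → Fin v → Rpos := fun a _ => ⟨a / ∑ j, m j, div_pos a.2 hs⟩
  have hσ : rowMap m hm hs ∘ σ = id := by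
    funext a
    apply Subtype.ext
    change ∑ j, m j * ((a : ℝ) / ∑ j, m j) = a
    rw [← Finset.sum_mul]
    field_simp
  refine ⟨q.map σ, fun ε hε => ?_, by rw [Ultrafilter.map_map, hσ, Ultrafilter.map_id]⟩
  change ∀ᶠ a : Rpos in (q : Filter Rpos), ∀ _ : Fin v, (a : ℝ) / ∑ j, m j < ε
  filter_upwards [hq (ε * ∑ j, m j) (by positivity)] with a ha _
  exact (div_lt_iff₀ hs).2 ha

end RowMap

/-- No row of an image partition regular matrix with nonnegative entries vanishes. -/
theorem IPR.row_sum_pos {u v : ℕ} {M : Fin u → Fin v → ℝ} (hMnn : ∀ i j, 0 ≤ M i j)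
    (hIPR : IPR M) (i : Fin u) : 0 < ∑ j, M i j := by
  obtain ⟨_, x, hx⟩ := hIPR 1 fun _ => 0
  obtain ⟨h, -⟩ := hx i
  refine (Finset.sum_nonneg fun j _ => hMnn i j).lt_of_ne fun h0 => h.ne' ?_
  have hzero := (Finset.sum_eq_zero_iff_of_nonneg fun j _ => hMnn i j).1 h0.symm
  exact Finset.sum_eq_zero fun j hj => by rw [hzero j hj, zero_mul]

/-- If `M` is a `u × v` matrix with entries from `ℝ⁺ ∪ {0}` which is IPR/ℝ⁺ and `C ⊆ ℝ⁺`
is a QC\* set near zero in `ℝ⁺`, then `{x ∈ (ℝ⁺)^v : M·x ∈ C^u}` is a QC\* set near zero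
in `(ℝ⁺)^v`. -/
theorem qcStar_preserved {u v : ℕ} (hu : 1 ≤ u) (hv : 1 ≤ v)
    (M : Fin u → Fin v → ℝ) (hMnn : ∀ i j, 0 ≤ M i j) (hIPR : IPR M)
    (C : Set ℝ) (hC : C ⊆ Set.Ioi 0) (hQC : QCStar1 {a : Rpos | (a : ℝ) ∈ C}) :
    QCStarV v {x : Fin v → Rpos | ∀ i : Fin u, (∑ j, M i j * (x j : ℝ)) ∈ C} := by
  intro p hpp hp0 hpK
  refine Filter.eventually_all.2 fun i => ?_
  have hs := hIPR.row_sum_pos hMnn i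
  let φ := rowMap (M i) (hMnn i) hs
  have hφ : ∀ x y, φ (x + y) = φ x + φ y := rowMap_add (M i) (hMnn i) hs
  have hmaps : MapsTo (Ultrafilter.map φ) (zeroPlusV v) zeroPlus1 :=
    mapsTo_map_rowMap (M i) (hMnn i) hs
  refine hQC (p.map φ) (by rw [← ultrafilter_map_add φ hφ, hpp]) (hmaps hp0) ?_
  exact map_mem_closure (continuous_ultrafilter_map φ) hpK fun q hq =>
    memK_map φ hφ (fun _ hp _ hq => zeroPlusV_add_mem hp hq) hmaps
      (surjOn_map_rowMap (M i) (hMnn i) hs) hq
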